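/- arXiv:2407.03194 — 5 statements merged into one kernel-verified Lean document; each statement's English description precedes it below -/
import Mathlib

section
/- Suppose an ensemble choice aggregator C respects model choice reversal. Then for all labels y,y' ∈ Y and all profiles z,z' ∈ S(Y): if for every model j one has z_j(y) > z_j(y') if and only if z'_j(y) > z'_j(y'), then C({y,y'},z) = C({y,y'},z'). -/
open Finset

attribute [local instance] Classical.propDecidable

/-- The set of valid score profiles `S(Y) = S_1 × ⋯ × S_m`. -/
def ProfileSet {Y : Type*} (m : ℕ) (Sj : Fin m → Set (Y → ℝ)) :
    Set (Fin m → Y → ℝ) := {z | ∀ j, z j ∈ Sj j}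

/-- `C` is an ensemble choice aggregator on the profile set `S`. -/
def IsECA {Y : Type*} [DecidableEq Y] {m : ℕ} (S : Set (Fin m → Y → ℝ))
    (C : Finset Y → (Fin m → Y → ℝ) → Finset Y) : Prop :=
  ∀ z ∈ S, ∀ Ys : Finset Y, Ys.Nonempty →
    C Ys z ⊆ Ys ∧ (C Ys z).Nonempty ∧
      ∀ y ∈ Ys, (¬ ∃ y' ∈ Ys, C {y, y'} z = {y'}) → y ∈ C Ys z

/-- Insertion/deletion consistency. -/
def IDConsistent {Y : Type*} [DecidableEq Y] {m : ℕ} (S : Set (Fin m → Y → ℝ))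
    (C : Finset Y → (Fin m → Y → ℝ) → Finset Y) : Prop :=
  ∀ z ∈ S, ∀ Y1 Y2 : Finset Y, Y1.Nonempty → Y1 ⊆ Y2 →
    (Y1 ∩ C Y2 z).Nonempty → C Y1 z = Y1 ∩ C Y2 z

/-- Transitivity of the aggregator. -/
def TransitiveAgg {Y : Type*} [DecidableEq Y] {m : ℕ} (S : Set (Fin m → Y → ℝ))
    (C : Finset Y → (Fin m → Y → ℝ) → Finset Y) : Prop :=
  ∀ z ∈ S, ∀ y y' y'' : Y,
    y ∈ C {y, y'} z → y' ∈ C {y', y''} z → y ∈ C {y, y''} z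

/-- Ensemble unanimity. -/
def Unanimity {Y : Type*} [DecidableEq Y] {m : ℕ} (S : Set (Fin m → Y → ℝ))
    (C : Finset Y → (Fin m → Y → ℝ) → Finset Y) : Prop :=
  ∀ z ∈ S, ∀ y y' : Y, (∀ j, z j y > z j y') → C {y, y'} z = {y}

/-- `C` respects model choice reversal. -/
def RespectsMCR {Y : Type*} [DecidableEq Y] {m : ℕ} (S : Set (Fin m → Y → ℝ))
    (C : Finset Y → (Fin m → Y → ℝ) → Finset Y) : Prop :=
  ∀ y y' : Y, ∀ z ∈ S, ∀ z' ∈ S,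
    y ∈ C {y, y'} z → y' ∉ C {y, y'} z → y' ∈ C {y, y'} z' →
    ∃ j, z j y > z j y' ∧ z' j y < z' j y'

/-- `C` is a nondegenerate ensemble choice aggregator. -/
def Nondegenerate {Y : Type*} [DecidableEq Y] {m : ℕ} (S : Set (Fin m → Y → ℝ))
    (C : Finset Y → (Fin m → Y → ℝ) → Finset Y) : Prop :=
  ¬ ∃ j : Fin m, ∀ y y' : Y, ∀ z ∈ S, z j y > z j y' → C {y, y'} z = {y}

/-- Model with score-vector range `Sjset` is an unconstrained learner. -/
def UnconstrainedLearner {Y : Type*} (Sjset : Set (Y → ℝ)) : Prop :=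
  ∀ R : Y → Y → Prop, (∀ a b, R a b ∨ R b a) →
    (∀ a b c, R a b → R b c → R a c) →
    ∃ v ∈ Sjset, ∀ a b, R a b ↔ v a ≥ v b

/-- Model `j` is decisive for `a` over `b`. -/
def Decisive {Y : Type*} [DecidableEq Y] {m : ℕ} (S : Set (Fin m → Y → ℝ))
    (C : Finset Y → (Fin m → Y → ℝ) → Finset Y) (j : Fin m) (a b : Y) : Prop :=
  ∀ z ∈ S, z j a > z j b → C {a, b} z = {a}

/-- if `C` respects model choice reversal and no model reverses its
comparison of `y` versus `y'` between profiles `z` and `z'`, then the ensemble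
choice between `y` and `y'` is the same at `z` and `z'`. -/
theorem mcr_same_choice {Y : Type*} [Fintype Y] [DecidableEq Y]
    {m : ℕ} (hm : 1 ≤ m) (Sj : Fin m → Set (Y → ℝ))
    (C : Finset Y → (Fin m → Y → ℝ) → Finset Y)
    (hC : IsECA (ProfileSet m Sj) C)
    (hMCR : RespectsMCR (ProfileSet m Sj) C)
    (y y' : Y) (z z' : Fin m → Y → ℝ)
    (hz : z ∈ ProfileSet m Sj) (hz' : z' ∈ ProfileSet m Sj)
    (h : ∀ j, z j y > z j y' ↔ z' j y > z' j y') :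
    C {y, y'} z = C {y, y'} z' := by
  have key : ∀ w ∈ ProfileSet m Sj, ∀ w' ∈ ProfileSet m Sj,
      (∀ j, w j y > w j y' ↔ w' j y > w' j y') → C {y, y'} w' ⊆ C {y, y'} w := by
    intro w hw w' hw' hh x hx
    by_contra hn
    obtain ⟨hs', -, -⟩ := hC w' hw' {y, y'} (by simp)
    obtain ⟨hs, ⟨t, ht⟩, -⟩ := hC w hw {y, y'} (by simp)
    have hx1 := hs' hx
    have ht1 := hs ht
    simp only [Finset.mem_insert, Finset.mem_singleton] at hx1 ht1
    have hxt : x ≠ t := fun e => hn (e ▸ ht)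
    rcases hx1 with rfl | rfl <;> rcases ht1 with rfl | rfl
    · exact hxt rfl
    · rw [Finset.pair_comm] at hx hn ht
      obtain ⟨j, h1, h2⟩ := hMCR _ _ w hw w' hw' ht hn hx
      exact lt_asymm h1 ((hh j).2 h2)
    · obtain ⟨j, h1, h2⟩ := hMCR _ _ w hw w' hw' ht hn hx
      exact lt_asymm h2 ((hh j).1 h1)
    · exact hxt rfl
  exact Finset.Subset.antisymm (key z' hz' z hz fun j => (h j).symm) (key z hz z' hz' h)
end

section
/- (Corollary for hard voting) Suppose |Y| ≥ 3, m ≥ 2, and S_j = ℝ^Y for every model j. Then the hard voting aggregator C_hv is not insertion/deletion consistent: there exist a profile z ∈ S(Y) and nonempty subsets Y₁* ⊆ Y₂* ⊆ Y with Y₁* ∩ C_hv(Y₂*,z) ≠ ∅ and C_hv(Y₁*,z) ≠ Y₁* ∩ C_hv(Y₂*,z). -/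
open Finset

attribute [local instance] Classical.propDecidable

/-- The hard voting aggregator: each model votes for the labels maximizing its
own score on `Ys`; choose the labels with a plurality of votes. -/
noncomputable def hardVote {Y : Type*} [DecidableEq Y] (m : ℕ) :
    Finset Y → (Fin m → Y → ℝ) → Finset Y :=
  fun Ys z => Ys.filter (fun y => ∀ y' ∈ Ys,
    (Finset.univ.filter (fun j : Fin m => ∀ y'' ∈ Ys, z j y'' ≤ z j y')).card ≤
    (Finset.univ.filter (fun j : Fin m => ∀ y'' ∈ Ys, z j y'' ≤ z j y)).card)

/-- Number of votes for `y`. -/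
noncomputable def nvotes {Y : Type*} {m : ℕ} (Ys : Finset Y) (z : Fin m → Y → ℝ) (y : Y) : ℕ :=
  Nat.card {j : Fin m // ∀ y'' ∈ Ys, z j y'' ≤ z j y}

theorem mem_hardVote' {Y : Type*} [DecidableEq Y] {m : ℕ} (Ys : Finset Y)
    (z : Fin m → Y → ℝ) (y : Y) :
    y ∈ hardVote m Ys z ↔ y ∈ Ys ∧ ∀ y' ∈ Ys, nvotes Ys z y' ≤ nvotes Ys z y := by
  have h : ∀ y, (Finset.univ.filter (fun j : Fin m => ∀ y'' ∈ Ys, z j y'' ≤ z j y)).card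
      = nvotes Ys z y := by
    intro y
    exact (Nat.subtype_card _ (by simp)).symm
  simp only [← h]
  unfold hardVote
  simp only [Finset.mem_filter]

/-- Corollary for hard voting: hard voting is not
insertion/deletion consistent. -/
theorem hard_voting_violates_idc {Y : Type*} [Fintype Y] [DecidableEq Y]
    {m : ℕ} (hY : 3 ≤ Fintype.card Y) (hm : 2 ≤ m) :
    ∃ (z : Fin m → Y → ℝ) (Y1 Y2 : Finset Y), Y1.Nonempty ∧ Y1 ⊆ Y2 ∧
      (Y1 ∩ hardVote m Y2 z).Nonempty ∧
      hardVote m Y1 z ≠ Y1 ∩ hardVote m Y2 z := by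
  obtain ⟨a, b, c, hab, hac, hbc⟩ := Fintype.two_lt_card_iff.mp (show 2 < Fintype.card Y by omega)
  obtain ⟨i0, i1, h01⟩ : ∃ i0 i1 : Fin m, i0 ≠ i1 :=
    ⟨⟨0, by omega⟩, ⟨1, by omega⟩, by simp⟩
  obtain ⟨z, hz⟩ : ∃ z : Fin m → Y → ℝ, z = fun j y =>
      if j = i0 then (if y = a then 2 else if y = b then 1 else 0)
      else if j = i1 then (if y = c then 2 else if y = b then 1 else 0) else 0 := ⟨_, rfl⟩
  have key : ∀ (Ys : Finset Y) (y : Y) (T : Finset (Fin m)),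
      (∀ j, (∀ y'' ∈ Ys, z j y'' ≤ z j y) ↔ j ∉ T) →
      nvotes Ys z y = m - T.card := by
    intro Ys y T h
    have := Nat.subtype_card (p := fun j => ∀ y'' ∈ Ys, z j y'' ≤ z j y) Tᶜ
      (by intro j; rw [h j, Finset.mem_compl])
    rw [nvotes, this, Finset.card_compl, Fintype.card_fin]
  have hba := hab.symm
  have hca := hac.symm
  have hcb := hbc.symm
  have h10 := h01.symm
  have hj : ∀ j, j = i0 ∨ j = i1 ∨ (j ≠ i0 ∧ j ≠ i1) := by intro j; tauto
  have k2a := key {a, b, c} a {i1} (by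
    intro j
    clear key
    rcases hj j with rfl | rfl | ⟨h0, h1⟩
    all_goals simp [*])
  have k2b := key {a, b, c} b {i0, i1} (by
    intro j
    clear key
    rcases hj j with rfl | rfl | ⟨h0, h1⟩
    all_goals simp [*])
  have k2c := key {a, b, c} c {i0} (by
    intro j
    clear key
    rcases hj j with rfl | rfl | ⟨h0, h1⟩
    all_goals simp [*])
  have k1a := key {a, b} a {i1} (by
    intro j
    clear key
    rcases hj j with rfl | rfl | ⟨h0, h1⟩
    all_goals simp [*])
  have k1b := key {a, b} b {i0} (by
    intro j
    clear key
    rcases hj j with rfl | rfl | ⟨h0, h1⟩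
    all_goals simp [*])
  rw [Finset.card_pair h01] at k2b
  rw [Finset.card_singleton] at k2a k2c k1a k1b
  have ha : a ∈ hardVote m {a, b, c} z := by
    refine (mem_hardVote' _ _ _).mpr ⟨by simp, ?_⟩
    intro y' hy'
    rw [k2a]
    simp only [Finset.mem_insert, Finset.mem_singleton] at hy'
    rcases hy' with rfl | rfl | rfl
    · rw [k2a]
    · rw [k2b]; omega
    · rw [k2c]
  have hb2 : b ∉ hardVote m {a, b, c} z := by
    intro h
    have := ((mem_hardVote' _ _ _).mp h).2 a (by simp)
    rw [k2a, k2b] at this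
    omega
  have hb1 : b ∈ hardVote m {a, b} z := by
    refine (mem_hardVote' _ _ _).mpr ⟨by simp, ?_⟩
    intro y' hy'
    rw [k1b]
    simp only [Finset.mem_insert, Finset.mem_singleton] at hy'
    rcases hy' with rfl | rfl
    · rw [k1a]
    · rw [k1b]
  refine ⟨z, {a, b}, {a, b, c}, by simp, ?_, ⟨a, by simp [ha]⟩, ?_⟩
  · intro y hy
    simp only [Finset.mem_insert, Finset.mem_singleton] at hy ⊢
    tauto
  · intro h
    rw [h] at hb1
    exact hb2 (Finset.mem_inter.mp hb1).2
end

section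
/- Suppose the profile set S(Y) is restricted so that for every z ∈ S(Y) there exists a strict total order P on Y such that for every model j and all distinct labels y,y': z_j(y) > z_j(y') if and only if y P y' (i.e., all models' scores in every profile induce a common strict ordering of the labels). Then any ensemble choice aggregator C on S(Y) that satisfies ensemble unanimity also respects model choice reversal. -/
open Finset

attribute [local instance] Classical.propDecidable

/-- if every profile in `S` induces a common strict total order of
the labels across all models, then ensemble unanimity implies model choice
reversal. -/
theorem unanimity_implies_mcr_on_ordered_profiles
    {Y : Type*} [Fintype Y] [DecidableEq Y]
    {m : ℕ} (hm : 1 ≤ m)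
    (S : Set (Fin m → Y → ℝ))
    (hres : ∀ z ∈ S, ∃ P : Y → Y → Prop,
      (∀ a, ¬ P a a) ∧ (∀ a b c, P a b → P b c → P a c) ∧
      (∀ a b, a ≠ b → P a b ∨ P b a) ∧
      (∀ j : Fin m, ∀ y y' : Y, y ≠ y' → (z j y > z j y' ↔ P y y')))
    (C : Finset Y → (Fin m → Y → ℝ) → Finset Y)
    (hC : IsECA S C)
    (hU : Unanimity S C) :
    RespectsMCR S C := by
  intro y y' z hz z' hz' h1 h2 h3
  have hne : y ≠ y' := by
    rintro rfl
    exact h2 h1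
  obtain ⟨P, _, _, hPt, hP⟩ := hres z hz
  obtain ⟨Q, _, _, hQt, hQ⟩ := hres z' hz'
  refine ⟨⟨0, hm⟩, ?_, ?_⟩
  · rcases hPt y y' hne with h | h
    · exact (hP _ y y' hne).2 h
    · exfalso
      have := hU z hz y' y (fun j => (hP j y' y hne.symm).2 h)
      rw [Finset.pair_comm] at this
      rw [this] at h2
      exact h2 (Finset.mem_singleton_self _)
  · rcases hQt y y' hne with h | h
    · exfalso
      have := hU z' hz' y y' (fun j => (hQ j y y' hne).2 h)
      rw [this] at h3
      exact hne (Finset.mem_singleton.1 h3).symm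
    · exact (hQ _ y' y hne.symm).2 h
end

section
/- (Deterministic core of the consistency theorem) Suppose |Y| ≥ 2, m ≥ 2, and S_j = ℝ^Y for every model j. Then the soft voting aggregator C_sv is a nondegenerate ensemble choice aggregator that satisfies insertion/deletion consistency and ensemble unanimity on S(Y); moreover, on the restricted profile set D ⊆ S(Y) consisting of all profiles z for which there exists a strict total order P on Y with z_j(y) > z_j(y') if and only if y P y' (for all j and all distinct y,y'), C_sv also respects model choice reversal, i.e., for all y,y' ∈ Y and all z,z' ∈ D: y ∈ C_sv({y,y'},z), y' ∉ C_sv({y,y'},z), and y' ∈ C_sv({y,y'},z') imply some model j has z_j(y) > z_j(y') and z'_j(y) < z'_j(y'). -/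
open Finset

attribute [local instance] Classical.propDecidable

/-- The soft voting aggregator: choose the labels maximizing the average score. -/
noncomputable def softVote {Y : Type*} [DecidableEq Y] (m : ℕ) :
    Finset Y → (Fin m → Y → ℝ) → Finset Y :=
  fun Ys z => Ys.filter (fun y => ∀ y' ∈ Ys,
    (∑ j, z j y') / (m : ℝ) ≤ (∑ j, z j y) / (m : ℝ))

theorem mem_sv {Y : Type*} [DecidableEq Y] {m : ℕ} (hm : 2 ≤ m) (Ys : Finset Y)
    (z : Fin m → Y → ℝ) (y : Y) :
    y ∈ softVote m Ys z ↔ y ∈ Ys ∧ ∀ y' ∈ Ys, ∑ j, z j y' ≤ ∑ j, z j y := by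
  have h : (0 : ℝ) < m := by exact_mod_cast (by omega : 0 < m)
  simp only [softVote, Finset.mem_filter, div_le_div_iff_of_pos_right h]

theorem sv_pair {Y : Type*} [DecidableEq Y] {m : ℕ} (hm : 2 ≤ m)
    (z : Fin m → Y → ℝ) (a b : Y) (h : ∑ j, z j b < ∑ j, z j a) :
    softVote m {a, b} z = {a} := by
  ext x
  rw [mem_sv hm]
  simp only [Finset.mem_insert, Finset.mem_singleton, forall_eq_or_imp, forall_eq]
  constructor
  · rintro ⟨rfl | rfl, h1, h2⟩
    · rfl
    · linarith
  · rintro rfl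
    exact ⟨Or.inl rfl, le_rfl, h.le⟩

/-- Deterministic core of the consistency theorem: with full
score ranges, soft voting is a nondegenerate ensemble choice aggregator
satisfying insertion/deletion consistency and ensemble unanimity, and on the
set of profiles whose scores all induce a common strict total order it also
respects model choice reversal. -/
theorem soft_voting_consistency {Y : Type*} [Fintype Y] [DecidableEq Y]
    {m : ℕ} (hY : 2 ≤ Fintype.card Y) (hm : 2 ≤ m) :
    IsECA (Set.univ : Set (Fin m → Y → ℝ)) (softVote m) ∧
    Nondegenerate (Set.univ : Set (Fin m → Y → ℝ)) (softVote m) ∧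
    IDConsistent (Set.univ : Set (Fin m → Y → ℝ)) (softVote m) ∧
    Unanimity (Set.univ : Set (Fin m → Y → ℝ)) (softVote m) ∧
    RespectsMCR
      {z : Fin m → Y → ℝ | ∃ P : Y → Y → Prop,
        (∀ a, ¬ P a a) ∧ (∀ a b c, P a b → P b c → P a c) ∧
        (∀ a b, a ≠ b → P a b ∨ P b a) ∧
        (∀ j : Fin m, ∀ y y' : Y, y ≠ y' → (z j y > z j y' ↔ P y y'))}
      (softVote m) := by
  have hne : (Finset.univ : Finset (Fin m)).Nonempty := ⟨⟨0, by omega⟩, Finset.mem_univ _⟩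
  refine ⟨?_, ?_, ?_, ?_, ?_⟩
  · intro z _ Ys hYs
    refine ⟨fun y hy => ((mem_sv hm _ _ _).1 hy).1, ?_, ?_⟩
    · obtain ⟨y, hy, h⟩ := Finset.exists_max_image Ys (fun y => ∑ j, z j y) hYs
      exact ⟨y, (mem_sv hm _ _ _).2 ⟨hy, h⟩⟩
    · intro y hy h
      refine (mem_sv hm _ _ _).2 ⟨hy, fun y' hy' => ?_⟩
      by_contra hc
      refine h ⟨y', hy', ?_⟩
      rw [Finset.pair_comm]
      exact sv_pair hm z y' y (not_le.1 hc)
  · rintro ⟨j, hj⟩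
    haveI : Nontrivial Y := Fintype.one_lt_card_iff_nontrivial.1 (by omega)
    haveI : Nontrivial (Fin m) := Fin.nontrivial_iff_two_le.2 hm
    obtain ⟨a, b, hab⟩ := exists_pair_ne Y
    obtain ⟨k, hk⟩ := exists_ne j
    let z : Fin m → Y → ℝ := fun i x =>
      if x = a then (if i = j then 1 else 0) else (if i = k then 2 else 0)
    have ha : ∑ i, z i a = 1 := by simp [z]
    have hb : ∑ i, z i b = 2 := by simp [z, hab.symm]
    have h1 := hj a b z (Set.mem_univ _) (by simp [z, hab.symm, hk.symm])
    have h2 := sv_pair hm z b a (by rw [ha, hb]; norm_num)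
    rw [Finset.pair_comm, h1] at h2
    exact hab (Finset.singleton_injective h2)
  · rintro z _ Y1 Y2 _ hsub ⟨w, hw⟩
    rw [Finset.mem_inter, mem_sv hm] at hw
    obtain ⟨hw1, _, hw2⟩ := hw
    ext x
    rw [Finset.mem_inter, mem_sv hm, mem_sv hm]
    constructor
    · rintro ⟨hx, h⟩
      exact ⟨hx, hsub hx, fun y hy => (hw2 y hy).trans (h w hw1)⟩
    · rintro ⟨hx, _, h⟩
      exact ⟨hx, fun y hy => h y (hsub hy)⟩
  · intro z _ y y' h
    exact sv_pair hm z y y' (Finset.sum_lt_sum_of_nonempty hne fun j _ => h j)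
  · rintro y y' z ⟨P, _, _, hP, hz⟩ z' ⟨Q, _, _, hQ, hz'⟩ h1 h2 h3
    have hyy : y ≠ y' := by
      rintro rfl
      exact h2 h1
    have key : ∀ w : Fin m → Y → ℝ, y' ∈ softVote m {y, y'} w →
        ¬ ∀ j, w j y' < w j y := by
      intro w hw hlt
      have := ((mem_sv hm _ _ _).1 hw).2 y (by simp)
      have := Finset.sum_lt_sum_of_nonempty hne fun j _ => hlt j
      linarith
    refine ⟨⟨0, by omega⟩, ?_, ?_⟩
    · refine (hz _ _ _ hyy).2 ((hP _ _ hyy).resolve_right fun h => h2 ?_)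
      rw [Finset.pair_comm, sv_pair hm z y' y
        (Finset.sum_lt_sum_of_nonempty hne fun j _ => (hz j _ _ hyy.symm).2 h)]
      simp
    · exact (hz' _ _ _ hyy.symm).2 ((hQ _ _ hyy).resolve_left fun h =>
        key z' h3 fun j => (hz' j _ _ hyy).2 h)
end

section
/- (Positively weighted stacking violates model choice reversal) Suppose |Y| ≥ 2, m ≥ 2, S_j = ℝ^Y for every model j, and let w_1,…,w_m be real weights with w_j > 0 for all j. Then the weighted aggregator C_w does not respect model choice reversal: there exist labels y,y' ∈ Y and profiles z,z' ∈ S(Y) with y ∈ C_w({y,y'},z), y' ∉ C_w({y,y'},z), y' ∈ C_w({y,y'},z'), and yet no model j satisfies both z_j(y) > z_j(y') and z'_j(y) < z'_j(y'). -/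
open Finset

attribute [local instance] Classical.propDecidable

/-- The weighted (stacking) aggregator: choose the labels maximizing the
weighted sum of scores. -/
noncomputable def weightedVote {Y : Type*} [DecidableEq Y] {m : ℕ}
    (w : Fin m → ℝ) : Finset Y → (Fin m → Y → ℝ) → Finset Y :=
  fun Ys z => Ys.filter (fun y => ∀ y' ∈ Ys,
    (∑ j, w j * z j y') ≤ (∑ j, w j * z j y))

/-- Positively weighted stacking violates model choice
reversal. -/
theorem weighted_voting_violates_mcr {Y : Type*} [Fintype Y] [DecidableEq Y]
    {m : ℕ} (hY : 2 ≤ Fintype.card Y) (hm : 2 ≤ m)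
    (w : Fin m → ℝ) (hw : ∀ j, 0 < w j) :
    ∃ (y y' : Y) (z z' : Fin m → Y → ℝ),
      y ∈ weightedVote w {y, y'} z ∧ y' ∉ weightedVote w {y, y'} z ∧
      y' ∈ weightedVote w {y, y'} z' ∧
      ¬ ∃ j, z j y > z j y' ∧ z' j y < z' j y' := by
  obtain ⟨a, b, hab⟩ := Fintype.exists_pair_of_one_lt_card (α := Y) (by omega)
  have hba : b ≠ a := hab.symm
  let i0 : Fin m := ⟨0, by omega⟩
  let i1 : Fin m := ⟨1, by omega⟩
  have h01 : i0 ≠ i1 := by simp [i0, i1]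
  let f : ℝ → ℝ → Fin m → Y → ℝ := fun p q j x =>
    if x = a then (if j = i0 then p / w j else 0) else (if j = i1 then q / w j else 0)
  have sa : ∀ p q, ∑ j, w j * f p q j a = p := by
    intro p q
    have := (hw i0).ne'
    simp only [f, if_true, mul_ite, mul_zero, Finset.sum_ite_eq', Finset.mem_univ]
    field_simp
  have sb : ∀ p q, ∑ j, w j * f p q j b = q := by
    intro p q
    have := (hw i1).ne'
    simp only [f, if_neg hba, if_true, mul_ite, mul_zero, Finset.sum_ite_eq', Finset.mem_univ]
    field_simp
  refine ⟨a, b, f 2 1, f 1 2, ?_, ?_, ?_, ?_⟩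
  · simp [weightedVote, sa, sb]
  · simp [weightedVote, sa, sb]
  · simp [weightedVote, sa, sb]
  · rintro ⟨j, h1, h2⟩
    have hj := hw j
    simp only [f, if_true, if_neg hba] at h1 h2
    by_cases h0 : j = i0
    · have hj1 : j ≠ i1 := fun h => h01 (h0.symm.trans h)
      rw [if_pos h0, if_neg hj1] at h2
      have : 0 < 1 / w j := by positivity
      linarith
    · rw [if_neg h0] at h1
      have : 0 ≤ (if j = i1 then 1 / w j else 0) := by
        split_ifs
        · positivity
        · exact le_rfl
      linarith
end
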